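/- arXiv:2102.00597 — 2 statements merged into one kernel-verified Lean document; each statement's English description precedes it below -/
import Mathlib

section
/- Let C be a nontrivial cyclic linear code of length n over GF(q). Then the minimum linear locality of C equals d(C⊥) − 1. -/
open scoped BigOperators

variable {F : Type*} [Field F] {ι : Type*} [Fintype ι]

/-- The Hamming weight of a word: the number of nonzero coordinates. -/
noncomputable def wt (c : ι → F) : ℕ := {i | c i ≠ 0}.ncard

/-- The minimum distance of a linear code: the least Hamming weight of a nonzero codeword. -/
noncomputable def minDist (C : Submodule F (ι → F)) : ℕ :=
  sInf {w | ∃ c ∈ C, c ≠ 0 ∧ wt c = w}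

/-- The dual code of a linear code. -/
def dualCode (C : Submodule F (ι → F)) : Submodule F (ι → F) where
  carrier := {x | ∀ c ∈ C, ∑ i, x i * c i = 0}
  add_mem' := by
    intro a b ha hb c hc
    have h1 := ha c hc
    have h2 := hb c hc
    simp only [Set.mem_setOf_eq, Pi.add_apply, add_mul, Finset.sum_add_distrib, h1, h2, add_zero]
  zero_mem' := by intro c hc; simp
  smul_mem' := by
    intro r a ha c hc
    have h := ha c hc
    simp only [Set.mem_setOf_eq, Pi.smul_apply, smul_eq_mul, mul_assoc, ← Finset.mul_sum, h,
      mul_zero]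

/-- `C` has linear locality `r`: every code symbol `c i` is a fixed linear combination of
at most `r` other code symbols. -/
def HasLinearLocality (C : Submodule F (ι → F)) (r : ℕ) : Prop :=
  ∀ i : ι, ∃ (R : Finset ι) (u : ι → F), i ∉ R ∧ R.card ≤ r ∧
    ∀ c ∈ C, c i = ∑ j ∈ R, u j * c j

omit [Fintype ι] in
theorem minDist_le_wt {C : Submodule F (ι → F)} {c : ι → F} (hc : c ∈ C) (h0 : c ≠ 0) :
    minDist C ≤ wt c :=
  Nat.sInf_le ⟨c, hc, h0, rfl⟩

omit [Fintype ι] in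
theorem exists_wt_eq_minDist {C : Submodule F (ι → F)} (h : minDist C ≠ 0) :
    ∃ c ∈ C, c ≠ 0 ∧ wt c = minDist C :=
  Nat.sInf_mem (Nat.nonempty_of_pos_sInf (Nat.pos_of_ne_zero h))

/-- A dual word that is nonzero at `i` gives a recovery set for `i`. -/
theorem exists_recovery_of_mem_dualCode {C : Submodule F (ι → F)} {x : ι → F}
    (hx : x ∈ dualCode C) {i : ι} (hi : x i ≠ 0) :
    ∃ (R : Finset ι) (u : ι → F), i ∉ R ∧ R.card ≤ wt x - 1 ∧
      ∀ c ∈ C, c i = ∑ j ∈ R, u j * c j := by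
  classical
  have hwt : wt x = (Finset.univ.filter fun j => x j ≠ 0).card := by
    rw [wt, ← Set.ncard_coe_finset]
    simp
  refine ⟨(Finset.univ.filter fun j => x j ≠ 0).erase i, fun j => -(x i)⁻¹ * x j, by simp,
    ?_, fun c hc => ?_⟩
  · rw [hwt, Finset.card_erase_of_mem (by simpa using hi)]
  · have h : ∑ j, x j * c j = 0 := hx c hc
    have hs : ∑ j ∈ Finset.univ.filter (fun j => x j ≠ 0), x j * c j = ∑ j, x j * c j :=
      Finset.sum_filter_of_ne fun j _ hj => left_ne_zero_of_mul hj
    rw [h, ← Finset.add_sum_erase _ _ (show i ∈ _ by simpa using hi)] at hs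
    simp only [mul_assoc, ← Finset.mul_sum]
    rw [eq_neg_of_add_eq_zero_right hs]
    field_simp

/-- A recovery set for `i` gives a dual word supported on it together with `i`. -/
theorem exists_mem_dualCode_of_recovery {C : Submodule F (ι → F)} {i : ι} {R : Finset ι}
    {u : ι → F} (hi : i ∉ R) (h : ∀ c ∈ C, c i = ∑ j ∈ R, u j * c j) :
    ∃ x ∈ dualCode C, x ≠ 0 ∧ wt x ≤ R.card + 1 := by
  classical
  refine ⟨fun k => (if k = i then 1 else 0) - if k ∈ R then u k else 0, fun c hc => ?_,
    fun h0 => ?_, ?_⟩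
  · simp [sub_mul, Finset.sum_sub_distrib, ite_mul, h c hc]
  · simpa [hi] using congrFun h0 i
  · rw [← Finset.card_insert_of_notMem hi, wt, ← Set.ncard_coe_finset]
    refine Set.ncard_le_ncard (fun k hk => ?_) (Finset.finite_toSet _)
    by_contra hk'
    simp_all

theorem shift_mem_of_cyclic {n : ℕ} [NeZero n] {C : Submodule F (Fin n → F)}
    (hcyc : ∀ c ∈ C, (fun i : Fin n => c (i - 1)) ∈ C) (s : Fin n) {c : Fin n → F}
    (hc : c ∈ C) : (fun i => c (i - s)) ∈ C := by
  open Fin.NatCast Fin.CommRing in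
  have key : ∀ m : ℕ, (fun i : Fin n => c (i - (m : Fin n))) ∈ C := by
    intro m
    induction m with
    | zero => simpa using hc
    | succ m ih =>
      convert hcyc _ ih using 3 with i
      push_cast
      ring
  simpa using key s

theorem shift_mem_dualCode_of_cyclic {n : ℕ} [NeZero n] {C : Submodule F (Fin n → F)}
    (hcyc : ∀ c ∈ C, (fun i : Fin n => c (i - 1)) ∈ C) (s : Fin n) {x : Fin n → F}
    (hx : x ∈ dualCode C) : (fun i => x (i - s)) ∈ dualCode C := by
  intro c hc
  rw [← hx _ (shift_mem_of_cyclic hcyc (-s) hc)]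
  exact Fintype.sum_equiv (Equiv.subRight s) _ _ fun i => by simp

omit [Fintype ι] in
theorem wt_comp_equiv (e : ι ≃ ι) (c : ι → F) : wt (fun i => c (e i)) = wt c :=
  Set.ncard_preimage_of_injective_subset_range (s := {i | c i ≠ 0}) e.injective
    (by simp [e.surjective.range_eq])

/-- A nontrivial cyclic linear code `C` of length `n` has minimum linear
locality `d(C⊥) - 1`. -/
theorem statement2 {n : ℕ} [NeZero n] (C : Submodule F (Fin n → F))
    (hcyc : ∀ c ∈ C, (fun i : Fin n => c (i - 1)) ∈ C)
    (h1 : 2 ≤ minDist C) (h2 : 2 ≤ minDist (dualCode C)) :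
    IsLeast {r : ℕ | HasLinearLocality C r} (minDist (dualCode C) - 1) := by
  obtain ⟨x, hx, hx0, hwt⟩ := exists_wt_eq_minDist (C := dualCode C) (by omega)
  obtain ⟨j, hj⟩ := Function.ne_iff.mp hx0
  refine ⟨fun i => ?_, fun r hr => ?_⟩
  · have hwt' : wt (fun k => x (k - (i - j))) = minDist (dualCode C) :=
      (wt_comp_equiv (Equiv.subRight (i - j)) x).trans hwt
    rw [← hwt']
    exact exists_recovery_of_mem_dualCode (shift_mem_dualCode_of_cyclic hcyc (i - j) hx)
      (by simpa using hj)
  · obtain ⟨R, u, hi, hR, h⟩ := hr 0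
    obtain ⟨y, hy, hy0, hwy⟩ := exists_mem_dualCode_of_recovery hi h
    have := minDist_le_wt hy hy0
    omega
end

section
/- Let q > 2 be a prime power and m ≥ 1 an integer. The first-order generalized Reed–Muller code C = R_q(1, m) = {(a·x + b)_{x ∈ GF(q)^m} : a ∈ GF(q)^m, b ∈ GF(q)} has length q^m, dimension m + 1, minimum distance (q − 1)q^{m−1}, and minimum linear locality 2; its dual code C⊥ has dimension q^m − 1 − m, minimum distance 3, and minimum linear locality (q − 1)q^{m−1} − 1. -/
open scoped BigOperators

variable {F : Type*} [Field F] {ι : Type*} [Fintype ι]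

/-- The first-order generalized Reed–Muller code `R_q(1, m)`: evaluation vectors of the affine
functions `x ↦ a·x + b` at all points of `GF(q)^m`. -/
def RM1 (F : Type*) [Field F] (m : ℕ) : Submodule F ((Fin m → F) → F) where
  carrier := {g | ∃ (a : Fin m → F) (b : F), ∀ x, g x = (∑ i, a i * x i) + b}
  add_mem' := by
    rintro g h ⟨a, b, hg⟩ ⟨a', b', hh⟩
    refine ⟨a + a', b + b', fun x => ?_⟩
    simp only [Pi.add_apply, hg x, hh x, add_mul, Finset.sum_add_distrib]
    ring
  zero_mem' := ⟨0, 0, fun x => by simp⟩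
  smul_mem' := by
    rintro r g ⟨a, b, hg⟩
    refine ⟨r • a, r * b, fun x => ?_⟩
    simp only [Pi.smul_apply, smul_eq_mul, hg x, mul_add, Finset.mul_sum, mul_assoc]

theorem mem_dualCode {C : Submodule F (ι → F)} {x : ι → F} :
    x ∈ dualCode C ↔ ∀ c ∈ C, ∑ i, x i * c i = 0 := Iff.rfl

theorem mem_RM1 {m : ℕ} {g : (Fin m → F) → F} :
    g ∈ RM1 F m ↔ ∃ (a : Fin m → F) (b : F), ∀ x, g x = (∑ i, a i * x i) + b := Iff.rfl

theorem wt_eq_card_filter [DecidableEq F] (c : ι → F) :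
    wt c = (Finset.univ.filter fun i => c i ≠ 0).card := by
  rw [wt, ← Set.ncard_coe_finset]
  simp

theorem minDist_eq {κ : Type*} {C : Submodule F (κ → F)} {d : ℕ}
    (hle : ∀ c ∈ C, c ≠ 0 → d ≤ wt c)
    (hex : ∃ c ∈ C, c ≠ 0 ∧ wt c = d) : minDist C = d := by
  apply le_antisymm
  · exact Nat.sInf_le hex
  · refine le_csInf ⟨d, hex⟩ ?_
    rintro _ ⟨c, hc, h0, rfl⟩
    exact hle c hc h0

/-- The standard dot product as a bilinear form. -/
def dotForm (F ι : Type*) [Field F] [Fintype ι] : LinearMap.BilinForm F (ι → F) :=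
  dotProductBilin F F

theorem dotForm_apply (x y : ι → F) : dotForm F ι x y = ∑ i, x i * y i := rfl

theorem dotForm_isRefl : (dotForm F ι).IsRefl := by
  intro x y h
  rw [dotForm_apply] at *
  simpa only [mul_comm] using h

theorem dotForm_nondegenerate : (dotForm F ι).Nondegenerate := by
  refine ⟨fun x hx => dotProduct_eq_zero x hx, fun x hx => dotProduct_eq_zero x fun y => ?_⟩
  rw [dotProduct_comm]
  exact hx y

theorem dualCode_eq_orthogonal (C : Submodule F (ι → F)) :
    dualCode C = (dotForm F ι).orthogonal C := by
  ext x
  simp only [mem_dualCode, LinearMap.BilinForm.mem_orthogonal_iff, dotForm_apply, mul_comm]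

theorem finrank_dualCode (C : Submodule F (ι → F)) :
    Module.finrank F (dualCode C) = Fintype.card ι - Module.finrank F C := by
  rw [dualCode_eq_orthogonal, LinearMap.BilinForm.finrank_orthogonal dotForm_nondegenerate,
    Module.finrank_fintype_fun_eq_card]

theorem dualCode_dualCode (C : Submodule F (ι → F)) : dualCode (dualCode C) = C := by
  rw [dualCode_eq_orthogonal, dualCode_eq_orthogonal,
    LinearMap.BilinForm.orthogonal_orthogonal dotForm_nondegenerate dotForm_isRefl]

/-- A code has linear locality `r` iff every coordinate lies in the support of a dual word of
weight at most `r + 1`. -/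
theorem hasLinearLocality_iff {C : Submodule F (ι → F)} {r : ℕ} :
    HasLinearLocality C r ↔ ∀ i, ∃ w ∈ dualCode C, w i ≠ 0 ∧ wt w ≤ r + 1 := by
  classical
  refine forall_congr' fun i => ⟨?_, ?_⟩
  · rintro ⟨R, u, hi, hR, h⟩
    refine ⟨fun j => if j = i then 1 else if j ∈ R then -u j else 0, ?_, by simp, ?_⟩
    · intro c hc
      beta_reduce
      rw [← Finset.add_sum_erase _ _ (Finset.mem_univ i), if_pos rfl, one_mul, h c hc,
        ← Finset.sum_subset (s₁ := R) (s₂ := Finset.univ.erase i), ← Finset.sum_add_distrib]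
      · refine Finset.sum_eq_zero fun j hj => ?_
        rw [if_neg (fun hji : j = i => hi (hji ▸ hj)), if_pos hj]
        ring
      · intro j hj
        simpa using fun hji : j = i => hi (hji ▸ hj)
      · intro j hj hjR
        rw [if_neg (Finset.ne_of_mem_erase hj), if_neg hjR, zero_mul]
    · rw [wt_eq_card_filter]
      calc _ ≤ (insert i R).card := by
            refine Finset.card_le_card fun j hj => ?_
            by_contra hjR
            simp_all
        _ ≤ R.card + 1 := Finset.card_insert_le _ _
        _ ≤ r + 1 := by lia
  · rintro ⟨w, hw, hwi, hwt⟩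
    have hmem : i ∈ Finset.univ.filter fun j => w j ≠ 0 := by simpa using hwi
    refine ⟨(Finset.univ.filter fun j => w j ≠ 0).erase i, fun j => -(w i)⁻¹ * w j,
      by simp, ?_, fun c hc => ?_⟩
    · rw [Finset.card_erase_of_mem hmem, ← wt_eq_card_filter]
      lia
    · have h := hw c hc
      rw [← Finset.sum_subset (Finset.subset_univ (Finset.univ.filter fun j => w j ≠ 0)),
        ← Finset.add_sum_erase _ _ hmem] at h
      · simp only [mul_assoc, ← Finset.mul_sum]
        rw [eq_neg_of_add_eq_zero_right h]
        field_simp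
      · intro j _ hj
        have : w j = 0 := by simpa using hj
        rw [this, zero_mul]

theorem isLeast_hasLinearLocality [Nonempty ι] {C : Submodule F (ι → F)} {r : ℕ}
    (hle : ∀ w ∈ dualCode C, w ≠ 0 → r + 1 ≤ wt w)
    (hex : ∀ i, ∃ w ∈ dualCode C, w i ≠ 0 ∧ wt w ≤ r + 1) :
    IsLeast {r : ℕ | HasLinearLocality C r} r := by
  refine ⟨hasLinearLocality_iff.2 hex, fun s hs => ?_⟩
  obtain ⟨w, hw, hwi, hwt⟩ := hasLinearLocality_iff.1 hs (Classical.arbitrary ι)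
  have := hle w hw fun h => hwi (by simp [h])
  lia

theorem one_mem_RM1 (m : ℕ) : (1 : (Fin m → F) → F) ∈ RM1 F m :=
  ⟨0, 1, fun x => by simp⟩

/-- Affine functions separate points. -/
theorem exists_mem_RM1_separating {m : ℕ} {x y : Fin m → F} (h : x ≠ y) :
    ∃ c ∈ RM1 F m, c x ≠ 0 ∧ c y = 0 := by
  classical
  obtain ⟨k, hk⟩ := Function.ne_iff.1 h
  refine ⟨fun z => z k - y k, ⟨Pi.single k 1, -y k, fun z => ?_⟩, sub_ne_zero.2 hk, sub_self _⟩
  simp [Pi.single_apply, sub_eq_add_neg]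

theorem finrank_RM1 (F : Type*) [Field F] (m : ℕ) : Module.finrank F (RM1 F m) = m + 1 := by
  let Φ : ((Fin m → F) × F) →ₗ[F] ((Fin m → F) → F) :=
    { toFun := fun p x => (∑ i, p.1 i * x i) + p.2
      map_add' := fun p p' => by
        ext x
        simp only [Prod.fst_add, Prod.snd_add, Pi.add_apply, add_mul, Finset.sum_add_distrib]
        ring
      map_smul' := fun r p => by
        ext x
        simp [mul_add, Finset.mul_sum, mul_assoc] }
  have hΦ : ∀ p x, Φ p x = (∑ i, p.1 i * x i) + p.2 := fun _ _ => rfl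
  have hinj : Function.Injective Φ := by
    classical
    rw [injective_iff_map_eq_zero]
    rintro ⟨a, b⟩ h
    have hx : ∀ x : Fin m → F, (∑ i, a i * x i) + b = 0 := fun x => by
      rw [← hΦ (a, b), h, Pi.zero_apply]
    have hb : b = 0 := by simpa using hx 0
    have ha : a = 0 := by
      ext k
      simpa [hb, Pi.single_apply] using hx (Pi.single k 1)
    rw [ha, hb, Prod.mk_zero_zero]
  have hrange : LinearMap.range Φ = RM1 F m := by
    ext g
    simp only [LinearMap.mem_range, mem_RM1, funext_iff, hΦ, Prod.exists, eq_comm]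
  rw [← hrange, LinearMap.finrank_range_of_inj hinj]
  simp

section Finite

variable [Fintype F] {m : ℕ}

/-- A nonconstant affine function on `GF(q)^m` has weight `(q - 1) q^(m - 1)`. -/
theorem wt_affine (hm : 1 ≤ m) {a : Fin m → F} (ha : a ≠ 0) (b : F)
    {g : (Fin m → F) → F} (hg : ∀ x, g x = (∑ i, a i * x i) + b) :
    wt g = (Fintype.card F - 1) * Fintype.card F ^ (m - 1) := by
  classical
  obtain ⟨k, hk⟩ := Function.ne_iff.1 ha
  let e : Fin m → F := Pi.single k (a k)⁻¹
  have hshift : ∀ x t, g (x + t • e) = g x + t := by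
    intro x t
    have hae : ∑ i, a i * e i = 1 := by
      simpa [e, Pi.single_apply] using mul_inv_cancel₀ hk
    have : ∑ i, a i * (t * e i) = t := by
      simp only [mul_left_comm _ t, ← Finset.mul_sum, hae, mul_one]
    simp only [hg, Pi.add_apply, Pi.smul_apply, smul_eq_mul, mul_add, Finset.sum_add_distrib, this]
    ring
  let E : {x // g x ≠ 0} × F ≃ {t : F // t ≠ 0} × (Fin m → F) :=
    { toFun := fun p => (⟨g p.1, p.1.2⟩, p.1.1 + (p.2 - g p.1) • e)
      invFun := fun p => (⟨p.2 + (p.1.1 - g p.2) • e, by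
        rw [hshift, add_sub_cancel]; exact p.1.2⟩, g p.2)
      left_inv := by
        rintro ⟨⟨x, hx⟩, t⟩
        simp [hshift, add_assoc, ← add_smul]
      right_inv := by
        rintro ⟨⟨t, ht⟩, x⟩
        simp [hshift, add_assoc, ← add_smul] }
  have hcard := Fintype.card_congr E
  have hwt : wt g = Fintype.card {x // g x ≠ 0} := by
    rw [wt_eq_card_filter, Fintype.card_subtype]
  have hF : Fintype.card {t : F // t ≠ 0} = Fintype.card F - 1 := by
    rw [Fintype.card_subtype_compl, Fintype.card_subtype_eq]
  obtain ⟨n, rfl⟩ : ∃ n, m = n + 1 := ⟨m - 1, by lia⟩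
  rw [Fintype.card_prod, Fintype.card_prod, hF, ← hwt, Fintype.card_fun, Fintype.card_fin,
    pow_succ, ← mul_assoc] at hcard
  exact Nat.eq_of_mul_eq_mul_right Fintype.card_pos hcard

theorem le_wt_of_mem_RM1 (hm : 1 ≤ m) {c : (Fin m → F) → F} (hc : c ∈ RM1 F m) (h0 : c ≠ 0) :
    (Fintype.card F - 1) * Fintype.card F ^ (m - 1) ≤ wt c := by
  classical
  obtain ⟨a, b, h⟩ := hc
  by_cases ha : a = 0
  · have hcb : ∀ x, c x = b := fun x => by simp [h, ha]
    have hb : b ≠ 0 := fun hb => h0 (funext fun x => by rw [hcb, hb, Pi.zero_apply])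
    have hwt : wt c = Fintype.card F ^ m := by simp [wt_eq_card_filter, hcb, hb]
    calc _ ≤ Fintype.card F * Fintype.card F ^ (m - 1) := Nat.mul_le_mul_right _ (Nat.sub_le _ _)
      _ = wt c := by rw [hwt, mul_pow_sub_one (by lia)]
  · exact (wt_affine hm ha b h).ge

theorem exists_mem_RM1_wt_eq (hm : 1 ≤ m) (x : Fin m → F) :
    ∃ c ∈ RM1 F m, c x ≠ 0 ∧ wt c = (Fintype.card F - 1) * Fintype.card F ^ (m - 1) := by
  have h : ∀ z : Fin m → F, (∑ i, (1 : Fin m → F) i * z i) + (1 - ∑ i, x i) =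
      (∑ i, (1 : Fin m → F) i * z i) + (1 - ∑ i, x i) := fun _ => rfl
  have : NeZero m := ⟨by lia⟩
  exact ⟨_, ⟨_, _, h⟩, by simp, wt_affine hm one_ne_zero _ h⟩

theorem three_le_wt_of_mem_dualCode_RM1 {w : (Fin m → F) → F} (hw : w ∈ dualCode (RM1 F m))
    (h0 : w ≠ 0) : 3 ≤ wt w := by
  classical
  obtain ⟨i, hi⟩ := Function.ne_iff.1 h0
  obtain ⟨j, hji, hj⟩ : ∃ j, j ≠ i ∧ w j ≠ 0 := by
    by_contra! h
    have hs := hw 1 (one_mem_RM1 m)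
    rw [Finset.sum_eq_single i (fun j _ hji => by simp [h j hji]) (by simp)] at hs
    exact hi (by simpa using hs)
  obtain ⟨k, hki, hkj, hk⟩ : ∃ k, k ≠ i ∧ k ≠ j ∧ w k ≠ 0 := by
    by_contra! h
    obtain ⟨c, hc, hci, hcj⟩ := exists_mem_RM1_separating hji.symm
    have hs := hw c hc
    rw [Finset.sum_eq_single i (fun k _ hki => ?_) (by simp)] at hs
    · exact mul_ne_zero hi hci hs
    · by_cases hkj : k = j
      · rw [hkj, hcj, mul_zero]
      · rw [h k hki hkj, zero_mul]
  rw [wt_eq_card_filter, ← Finset.card_eq_three.2 ⟨i, j, k, hji.symm, hki.symm, hkj.symm, rfl⟩]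
  refine Finset.card_le_card fun x hx => ?_
  simp only [Finset.mem_insert, Finset.mem_singleton] at hx
  rcases hx with rfl | rfl | rfl <;> simpa

/-- Three collinear points support a word of the dual of `R_q(1, m)`. -/
theorem exists_mem_dualCode_RM1_wt_le (hF : 2 < Fintype.card F) (hm : 1 ≤ m) (x : Fin m → F) :
    ∃ w ∈ dualCode (RM1 F m), w x ≠ 0 ∧ wt w ≤ 3 := by
  classical
  have : NeZero m := ⟨by lia⟩
  obtain ⟨t, ht⟩ : ∃ t : F, t ∉ ({0, 1} : Finset F) := by
    by_contra! h
    have := Finset.card_le_card (fun t _ => h t : Finset.univ ⊆ ({0, 1} : Finset F))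
    have := Finset.card_le_two (a := (0 : F)) (b := 1)
    rw [Finset.card_univ] at *
    lia
  simp only [Finset.mem_insert, Finset.mem_singleton, not_or] at ht
  obtain ⟨ht0, ht1⟩ := ht
  refine ⟨Pi.single x (t - 1) + Pi.single (x + 1) (-t) + Pi.single (x + t • 1) 1, ?_, ?_, ?_⟩
  · rintro c ⟨a, b, h⟩
    simp only [Pi.add_apply, add_mul, Finset.sum_add_distrib, Pi.single_apply, ite_mul, zero_mul,
      Finset.sum_ite_eq', Finset.mem_univ, if_true, h, mul_add, Pi.smul_apply, Pi.one_apply,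
      smul_eq_mul, mul_one, ← Finset.sum_mul]
    ring
  · have h1 : x ≠ x + 1 := by simp
    have h2 : x ≠ x + t • 1 := by simp [ht0]
    simpa [Pi.single_apply, h1, h2, sub_eq_zero] using ht1
  · rw [wt_eq_card_filter]
    refine (Finset.card_le_card (t := {x, x + 1, x + t • 1}) fun z hz => ?_).trans
      Finset.card_le_three
    by_contra hzn
    simp_all [Pi.single_apply]

end Finite

/-- For `q > 2`, the first-order generalized Reed–Muller code `R_q(1, m)` has
length `q^m`, dimension `m + 1`, minimum distance `(q-1)q^(m-1)` and minimum linear locality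
`2`; its dual has dimension `q^m - 1 - m`, minimum distance `3` and minimum linear locality
`(q-1)q^(m-1) - 1`. -/
theorem statement11 {F : Type*} [Field F] [Fintype F] (q m : ℕ)
    (hq : Fintype.card F = q) (hq2 : 2 < q) (hm : 1 ≤ m) :
    Fintype.card (Fin m → F) = q ^ m ∧
    Module.finrank F (RM1 F m) = m + 1 ∧
    minDist (RM1 F m) = (q - 1) * q ^ (m - 1) ∧
    IsLeast {r : ℕ | HasLinearLocality (RM1 F m) r} 2 ∧
    Module.finrank F (dualCode (RM1 F m)) = q ^ m - 1 - m ∧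
    minDist (dualCode (RM1 F m)) = 3 ∧
    IsLeast {r : ℕ | HasLinearLocality (dualCode (RM1 F m)) r} ((q - 1) * q ^ (m - 1) - 1) := by
  subst hq
  have hpos : 1 ≤ (Fintype.card F - 1) * Fintype.card F ^ (m - 1) :=
    Nat.mul_pos (by lia) (Nat.pow_pos (by lia))
  have hcard : Fintype.card (Fin m → F) = Fintype.card F ^ m := by simp
  refine ⟨hcard, finrank_RM1 F m, ?_, ?_, ?_, ?_, ?_⟩
  · obtain ⟨c, hc, hc0, hwt⟩ := exists_mem_RM1_wt_eq (F := F) hm 0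
    exact minDist_eq (fun _ => le_wt_of_mem_RM1 hm) ⟨c, hc, fun h => hc0 (by simp [h]), hwt⟩
  · exact isLeast_hasLinearLocality (fun _ => three_le_wt_of_mem_dualCode_RM1)
      (exists_mem_dualCode_RM1_wt_le hq2 hm)
  · rw [finrank_dualCode, finrank_RM1, hcard]
    lia
  · obtain ⟨w, hw, hw0, hwt⟩ := exists_mem_dualCode_RM1_wt_le (F := F) hq2 hm 0
    have hne : w ≠ 0 := fun h => hw0 (by simp [h])
    exact minDist_eq (fun _ => three_le_wt_of_mem_dualCode_RM1)
      ⟨w, hw, hne, hwt.antisymm (three_le_wt_of_mem_dualCode_RM1 hw hne)⟩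
  · apply isLeast_hasLinearLocality <;> rw [dualCode_dualCode, Nat.sub_add_cancel hpos]
    · exact fun _ => le_wt_of_mem_RM1 hm
    · exact fun x => (exists_mem_RM1_wt_eq hm x).imp fun _ h => ⟨h.1, h.2.1, h.2.2.le⟩
end
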